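/- Let M be an R-module projective in σ[M] which is semiprime (i.e., 0 is semiprime in M). If N and L are submodules of M with N_M L = 0, then L_M N = 0 and N ∩ L = 0. -/

import Mathlib

/- Common definitions: the category σ[M], projectivity in σ[M], the product
   K_M L of submodules, annihilators, prime/semiprime submodules, hereditary
   torsion theories, M-singular modules, etc., following the paper. -/

universe u v

section Defs

variable (R : Type u) [Ring R]

/-- `N` belongs to `σ[M]`: `N` is isomorphic to a submodule of an `M`-generated
module, i.e. `N` embeds into a quotient of a direct sum of copies of `M`. -/
def InSigma (M : Type v) [AddCommGroup M] [Module R M]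
    (N : Type v) [AddCommGroup N] [Module R N] : Prop :=
  ∃ (ι : Type v) (K : Submodule R (ι →₀ M)) (g : N →ₗ[R] ((ι →₀ M) ⧸ K)),
    Function.Injective g

/-- `M` is projective in `σ[M]`. -/
def ProjInSigma (M : Type v) [AddCommGroup M] [Module R M] : Prop :=
  ∀ (A B : Type v) [AddCommGroup A] [Module R A] [AddCommGroup B] [Module R B],
    InSigma R M A → InSigma R M B →
      ∀ (p : A →ₗ[R] B), Function.Surjective p →
        ∀ f : M →ₗ[R] B, ∃ g : M →ₗ[R] A, p.comp g = f

variable (M : Type v) [AddCommGroup M] [Module R M]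

/-- The product `K_M L = Σ { f(K) : f ∈ Hom_R(M, L) }` of submodules of `M`. -/
def prodM (K L : Submodule R M) : Submodule R M :=
  ⨆ f ∈ {f : M →ₗ[R] M | LinearMap.range f ≤ L}, Submodule.map f K

/-- `Ann_M(X) = ∩ { ker f : f ∈ Hom_R(M, X) }`. -/
def annM (X : Type v) [AddCommGroup X] [Module R X] : Submodule R M :=
  ⨅ f : M →ₗ[R] X, LinearMap.ker f

/-- The right annihilator `Ann_M^r(N) = Σ { L ⊆ M : N_M L = 0 }`. -/
def annMr (N : Submodule R M) : Submodule R M :=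
  sSup {L : Submodule R M | prodM R M N L = ⊥}

/-- A submodule is fully invariant if it is stable under all endomorphisms. -/
def IsFullyInvariant (N : Submodule R M) : Prop :=
  ∀ f : M →ₗ[R] M, Submodule.map f N ≤ N

/-- `M` is a semiprime module: `K_M K = 0` implies `K = 0`. -/
def IsSemiprime : Prop :=
  ∀ K : Submodule R M, prodM R M K K = ⊥ → K = ⊥

/-- `P` is prime in `M`. -/
def PrimeIn (P : Submodule R M) : Prop :=
  P ≠ ⊤ ∧ IsFullyInvariant R M P ∧
    ∀ K L : Submodule R M, IsFullyInvariant R M K → IsFullyInvariant R M L →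
      prodM R M K L ≤ P → K ≤ P ∨ L ≤ P

/-- `P` is a minimal prime in `M`. -/
def MinPrimeIn (P : Submodule R M) : Prop :=
  PrimeIn R M P ∧ ∀ Q : Submodule R M, PrimeIn R M Q → Q ≤ P → Q = P

/-- Powers of a submodule: `powM N k = N^(k+1)`, i.e. `powM N 0 = N` and
`powM N (k+1) = N_M (powM N k)`. -/
def powM (N : Submodule R M) : ℕ → Submodule R M
  | 0 => N
  | k + 1 => prodM R M N (powM N k)

/-- The set of annihilator submodules `∩_{f ∈ X} ker f` for `X ⊆ End_R(M)`. -/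
def AnnSet : Set (Submodule R M) :=
  {N | ∃ X : Set (M →ₗ[R] M), N = ⨅ f ∈ X, LinearMap.ker f}

/-- `M` satisfies ACC on annihilators. -/
def AccOnAnnihilators : Prop :=
  ∀ c : ℕ → Submodule R M, (∀ n, c n ∈ AnnSet R M) → Monotone c →
    ∃ n, ∀ m, n ≤ m → c m = c n

/-- `U` is a uniform submodule of `M`. -/
def UniformSub (U : Submodule R M) : Prop :=
  U ≠ ⊥ ∧ ∀ A B : Submodule R M, A ≤ U → B ≤ U → A ≠ ⊥ → B ≠ ⊥ → A ⊓ B ≠ ⊥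

end Defs

section Torsion

variable (R : Type u) [Ring R]

/-- A hereditary torsion theory, presented via its torsion class: a class of
modules closed under submodules, quotients, extensions, isomorphisms and
direct sums. -/
structure HTC : Type (max u (v + 1)) where
  torsion : ∀ (N : Type v) [AddCommGroup N] [Module R N], Prop
  closed_sub : ∀ (N : Type v) [AddCommGroup N] [Module R N],
    torsion N → ∀ K : Submodule R N, torsion K
  closed_quot : ∀ (N : Type v) [AddCommGroup N] [Module R N],
    torsion N → ∀ K : Submodule R N, torsion (N ⧸ K)
  closed_ext : ∀ (N : Type v) [AddCommGroup N] [Module R N] (K : Submodule R N),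
    torsion K → torsion (N ⧸ K) → torsion N
  closed_iso : ∀ (N N' : Type v) [AddCommGroup N] [Module R N]
    [AddCommGroup N'] [Module R N'], (N ≃ₗ[R] N') → torsion N → torsion N'
  closed_dsum : ∀ (ι : Type v) (F : ι → Type v) [DecidableEq ι]
    [∀ i, AddCommGroup (F i)] [∀ i, Module R (F i)],
    (∀ i, torsion (F i)) → torsion (DirectSum ι F)

/-- `N` is `τ`-torsion-free. -/
def TorsionFreeFor (τ : HTC.{u, v} R) (N : Type v) [AddCommGroup N] [Module R N] : Prop :=
  ∀ K : Submodule R N, τ.torsion ↥K → K = ⊥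

variable (M : Type v) [AddCommGroup M] [Module R M]

/-- `N` is `χ(M)`-torsion: torsion for some (hence for the greatest) hereditary
torsion theory for which `M` is torsion-free. -/
def ChiTorsion (N : Type v) [AddCommGroup N] [Module R N] : Prop :=
  ∃ τ : HTC.{u, v} R, TorsionFreeFor R τ M ∧ τ.torsion N

/-- `N` is `χ(M)`-torsion-free. -/
def ChiTorsionFree (N : Type v) [AddCommGroup N] [Module R N] : Prop :=
  ∀ K : Submodule R N, ChiTorsion R M ↥K → K = ⊥

/-- `X` is `M`-singular: `X ≅ L/K` with `L ∈ σ[M]` and `K` essential in `L`. -/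
def IsMSingular (X : Type v) [AddCommGroup X] [Module R X] : Prop :=
  ∃ (L : Type v) (iL : AddCommGroup L)
    (mL : @Module R L inferInstance iL.toAddCommMonoid),
    letI := iL
    letI := mL
    InSigma R M L ∧ ∃ K : Submodule R L,
      (∀ K' : Submodule R L, K' ≠ ⊥ → K ⊓ K' ≠ ⊥) ∧ Nonempty (X ≃ₗ[R] (L ⧸ K))

/-- The `M`-singular submodule `Z(M)` of `M`. -/
def singularSub : Submodule R M :=
  sSup {K : Submodule R M | IsMSingular R M ↥K}

/-- `Ass_M(X)`: the set of primes in `M` associated to `X`. -/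
def AssM (X : Type v) [AddCommGroup X] [Module R X] : Set (Submodule R M) :=
  {P | P ≠ ⊤ ∧ IsFullyInvariant R M P ∧
    ∃ L : Submodule R X, L ≠ ⊥ ∧
      ∀ L' : Submodule R X, L' ≠ ⊥ → L' ≤ L → annM R M ↥L' = P}

/-- `E` is an injective object of `σ[M]`. -/
def InjInSigma (E : Type v) [AddCommGroup E] [Module R E] : Prop :=
  InSigma R M E ∧
    ∀ (B : Type v) [AddCommGroup B] [Module R B], InSigma R M B →
      ∀ (A : Submodule R B) (f : ↥A →ₗ[R] E),
        ∃ g : B →ₗ[R] E, ∀ a : A, g ↑a = f a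

/-- `E` is an indecomposable module. -/
def Indecomp (E : Type v) [AddCommGroup E] [Module R E] : Prop :=
  (⊥ : Submodule R E) ≠ ⊤ ∧
    ∀ A B : Submodule R E, IsCompl A B → A = ⊥ ∨ A = ⊤

/-- `M` has finite uniform dimension: there is no infinite independent family
of nonzero submodules. -/
def FiniteUniformDimension : Prop :=
  ¬ ∃ f : ℕ → Submodule R M, (∀ n, f n ≠ ⊥) ∧
      ∀ n : ℕ, f n ⊓ (⨆ m ∈ {m : ℕ | m ≠ n}, f m) = ⊥

/-- `M` is a continuous module (conditions C1 and C2). -/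
def ContinuousModule : Prop :=
  (∀ N : Submodule R M, ∃ D : Submodule R M, (∃ D', IsCompl D D') ∧ N ≤ D ∧
      ∀ L : Submodule R M, L ≤ D → L ≠ ⊥ → N ⊓ L ≠ ⊥) ∧
  (∀ N D : Submodule R M, (∃ D', IsCompl D D') → Nonempty (↥N ≃ₗ[R] ↥D) →
      ∃ N', IsCompl N N')

end Torsion

section ProductOfSubmodules

variable {R : Type u} [Ring R] {M : Type v} [AddCommGroup M] [Module R M]

theorem prodM_le_iff {K L P : Submodule R M} :
    prodM R M K L ≤ P ↔
      ∀ f : M →ₗ[R] M, LinearMap.range f ≤ L → Submodule.map f K ≤ P := by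
  simp only [prodM, iSup_le_iff, Set.mem_ofPred_eq]

theorem prodM_mono {K K' L L' : Submodule R M} (hK : K ≤ K') (hL : L ≤ L') :
    prodM R M K L ≤ prodM R M K' L' :=
  prodM_le_iff.2 fun f hf =>
    (Submodule.map_mono hK).trans (prodM_le_iff.1 le_rfl f (hf.trans hL))

theorem prodM_le_right (K L : Submodule R M) : prodM R M K L ≤ L :=
  prodM_le_iff.2 fun _ hf => LinearMap.map_le_range.trans hf

theorem inSigma_of_injective {X : Type v} [AddCommGroup X] [Module R X] {ι : Type v}
    (g : X →ₗ[R] (ι →₀ M)) (hg : Function.Injective g) : InSigma R M X :=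
  ⟨ι, ⊥, (Submodule.quotEquivOfEqBot ⊥ rfl).symm.toLinearMap.comp g,
    (Submodule.quotEquivOfEqBot ⊥ rfl).symm.injective.comp hg⟩

theorem inSigma_submodule (P : Submodule R M) : InSigma R M P :=
  inSigma_of_injective ((Finsupp.lsingle PUnit.unit).comp P.subtype)
    ((Finsupp.single_injective PUnit.unit).comp P.subtype_injective)

theorem inSigma_finsupp_submodule (ι : Type v) (P : Submodule R M) :
    InSigma R M (ι →₀ P) :=
  inSigma_of_injective (Finsupp.mapRange.linearMap P.subtype)
    (Finsupp.mapRange_injective _ P.subtype.map_zero P.subtype_injective)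

/-- Half of the associativity of the product, in the case where the left-hand product vanishes:
maps into `L_M P` lift along `⨁ L → L_M P`, and their components kill `N`. -/
theorem prodM_prodM_eq_bot (hproj : ProjInSigma R M) {N L : Submodule R M}
    (h : prodM R M N L = ⊥) (P : Submodule R M) :
    prodM R M N (prodM R M L P) = ⊥ := by
  rw [eq_bot_iff, prodM_le_iff]
  intro g hg
  let p : ({f : M →ₗ[R] M // LinearMap.range f ≤ P} →₀ L) →ₗ[R] M :=
    Finsupp.lsum ℕ fun f => f.1.comp L.subtype
  have hp : prodM R M L P ≤ LinearMap.range p := by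
    rw [prodM_le_iff]
    rintro f hf _ ⟨x, hx, rfl⟩
    exact ⟨Finsupp.single ⟨f, hf⟩ ⟨x, hx⟩, by simp [p]⟩
  obtain ⟨q, hq⟩ := hproj _ _ (inSigma_finsupp_submodule _ L)
    (inSigma_submodule (LinearMap.range p)) p.rangeRestrict p.surjective_rangeRestrict
    (g.codRestrict _ fun x => hp (hg ⟨x, rfl⟩))
  rintro _ ⟨x, hx, rfl⟩
  have hqx : q x = 0 := by
    ext f
    have hc : LinearMap.range (L.subtype.comp ((Finsupp.lapply f).comp q)) ≤ L := by
      rintro _ ⟨y, rfl⟩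
      exact (q y f).2
    have hx0 := prodM_le_iff.1 h.le _ hc ⟨x, hx, rfl⟩
    simpa using hx0
  have hgx : p (q x) = g x := congrArg Subtype.val (LinearMap.congr_fun hq x)
  rw [Submodule.mem_bot, ← hgx, hqx, map_zero]

end ProductOfSubmodules

/-- in a semiprime module, `N_M L = 0` implies `L_M N = 0` and
`N ∩ L = 0`. -/
theorem stmt_2 (R : Type u) [Ring R] (M : Type v) [AddCommGroup M] [Module R M]
    (hproj : ProjInSigma R M) (hsemi : IsSemiprime R M)
    (N L : Submodule R M) (h : prodM R M N L = ⊥) :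
    prodM R M L N = ⊥ ∧ N ⊓ L = ⊥ := by
  refine ⟨hsemi _ (eq_bot_iff.2 ?_), hsemi _ (eq_bot_iff.2 ?_)⟩
  · exact (prodM_mono (prodM_le_right L N) le_rfl).trans (prodM_prodM_eq_bot hproj h N).le
  · exact (prodM_mono inf_le_left inf_le_right).trans h.le
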